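/- The only rational solution (x, y) of the equation y^2 = x^3 + 4500x is (x, y) = (0, 0). Equivalently, the Mordell--Weil group of the elliptic curve E : y^2 = x^3 + 4500x over \mathbb{Q} consists exactly of the identity O and the point (0, 0). -/

import Mathlib

theorem sq_int_of_rat (q : ℚ) (n : ℤ) (h : q ^ 2 = n) : ∃ z : ℤ, q = z := by
  have : IsIntegral ℤ q := by
    refine IsIntegral.of_pow (n := 2) (by norm_num) ?_
    rw [h]
    exact isIntegral_algebraMap (R := ℤ) (A := ℚ) (x := n)
  obtain ⟨z, hz⟩ := IsIntegrallyClosed.isIntegral_iff.mp this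
  exact ⟨z, by simpa using hz.symm⟩

theorem core (k : ℤ) (x y : ℚ) (h : y ^ 2 = x ^ 3 + k * x) (hx : x ≠ 0) :
    ∃ c c' M e N : ℤ, Squarefree c ∧ c * c' = k ∧ IsCoprime M e ∧ e ≠ 0 ∧
      x = c * (M / e) ^ 2 ∧ N ^ 2 = c * M ^ 4 + c' * e ^ 4 := by
  obtain ⟨A, hA⟩ : ∃ A : ℤ, A = x.num := ⟨_, rfl⟩
  obtain ⟨B, hB⟩ : ∃ B : ℤ, B = x.den := ⟨_, rfl⟩
  have hBpos : 0 < B := by rw [hB]; exact_mod_cast x.den_pos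
  have hB0 : (B : ℚ) ≠ 0 := by exact_mod_cast hBpos.ne'
  have hxAB : x = A / B := by
    rw [hA, hB]; push_cast; exact (Rat.num_div_den x).symm
  have hA0 : A ≠ 0 := by rw [hA]; exact Rat.num_ne_zero.mpr hx
  have hcop : IsCoprime A B := by
    rw [hA, hB, Int.isCoprime_iff_gcd_eq_one]
    exact x.reduced
  have h1 : (y * B ^ 2) ^ 2 = ((B * (A * (A ^ 2 + k * B ^ 2)) : ℤ) : ℚ) := by
    push_cast
    rw [mul_pow, h, hxAB]
    field_simp
  obtain ⟨Z, hZ⟩ := sq_int_of_rat _ _ h1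
  rw [hZ] at h1
  have h2 : B * (A * (A ^ 2 + k * B ^ 2)) = Z ^ 2 := by exact_mod_cast h1.symm
  have hcop2 : IsCoprime B (A * (A ^ 2 + k * B ^ 2)) := by
    refine IsCoprime.mul_right hcop.symm ?_
    have : IsCoprime B (A ^ 2) := hcop.symm.pow_right
    have h3 := this.add_mul_left_right (k * B)
    rwa [show A ^ 2 + B * (k * B) = A ^ 2 + k * B ^ 2 by ring] at h3
  obtain ⟨e, he⟩ := Int.sq_of_isCoprime hcop2 h2
  have he : B = e ^ 2 := by
    rcases he with he | he
    · exact he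
    · nlinarith [sq_nonneg e]
  have he0 : e ≠ 0 := by rintro rfl; simp at he; omega
  obtain ⟨f, hf⟩ := Int.sq_of_isCoprime hcop2.symm ((mul_comm _ _).trans h2)
  have hf : A * (A ^ 2 + k * B ^ 2) = f ^ 2 := by
    rcases hf with hf | hf
    · exact hf
    · rw [hf] at h2 ⊢
      have h3 : f ^ 2 = 0 := by
        by_contra h0
        have : 0 < f ^ 2 := lt_of_le_of_ne (sq_nonneg f) (Ne.symm h0)
        nlinarith [sq_nonneg Z]
      rw [h3]; norm_num
  obtain ⟨d, m, hdm, hsq⟩ := Nat.sq_mul_squarefree A.natAbs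
  obtain ⟨c, hc, hAc⟩ : ∃ c : ℤ, Squarefree c ∧ A = c * (m : ℤ) ^ 2 := by
    have hd : Squarefree (d : ℤ) := Int.squarefree_natCast.mpr hsq
    rcases Int.natAbs_eq A with h' | h'
    · refine ⟨d, hd, ?_⟩
      rw [h', ← hdm]; push_cast; ring
    · refine ⟨-d, ?_, ?_⟩
      · rw [← Int.squarefree_natAbs]; simpa using hsq
      · rw [h', ← hdm]; push_cast; ring
  obtain ⟨M, hM⟩ : ∃ M : ℤ, M = m := ⟨_, rfl⟩
  rw [← hM] at hAc
  have hM0 : M ≠ 0 := by rintro h0; rw [h0] at hAc; simp at hAc; exact hA0 hAc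
  have hc0 : c ≠ 0 := hc.ne_zero
  have hf2 : M ^ 2 * (c * (c ^ 2 * M ^ 4 + k * e ^ 4)) = f ^ 2 := by
    rw [← hf, hAc, he]; ring
  obtain ⟨g, hg⟩ : M ∣ f := (Int.pow_dvd_pow_iff (n := 2) (by norm_num)).mp ⟨_, hf2.symm⟩
  have hg2 : c * (c ^ 2 * M ^ 4 + k * e ^ 4) = g ^ 2 := by
    have : M ^ 2 ≠ 0 := pow_ne_zero _ hM0
    apply mul_left_cancel₀ this
    rw [hf2, hg]; ring
  obtain ⟨N, hN⟩ : c ∣ g := (hc.dvd_pow_iff_dvd (n := 2) (by norm_num)).mp ⟨_, hg2.symm⟩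
  have hN2 : c ^ 2 * M ^ 4 + k * e ^ 4 = c * N ^ 2 := by
    apply mul_left_cancel₀ hc0
    rw [hg2, hN]; ring
  rw [hAc, he] at hcop
  have hce : IsCoprime c e :=
    (IsCoprime.pow_right_iff (by norm_num : 0 < 2)).mp hcop.of_mul_left_left
  have hMe : IsCoprime M e :=
    (IsCoprime.pow_iff (by norm_num : 0 < 2) (by norm_num : 0 < 2)).mp hcop.of_mul_left_right
  have hck : c ∣ k := by
    have : c ∣ k * e ^ 4 := ⟨N ^ 2 - c * M ^ 4, by linear_combination hN2⟩
    exact (hce.pow_right (n := 4)).dvd_of_dvd_mul_right this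
  obtain ⟨c', hc'⟩ := hck
  refine ⟨c, c', M, e, N, hc, hc'.symm, hMe, he0, ?_, ?_⟩
  · rw [hxAB, hAc, he]; push_cast; ring
  · apply mul_left_cancel₀ hc0
    rw [← hN2, hc']; ring

theorem not_both {p : ℤ} (hp : Prime p) {M e : ℤ} (h : IsCoprime M e) (h1 : p ∣ M) (h2 : p ∣ e) :
    False := hp.not_isUnit (h.isUnit_of_dvd' h1 h2)

theorem prime3 : Prime (3 : ℤ) := Int.prime_three
theorem prime5 : Prime (5 : ℤ) := Int.prime_iff_natAbs_prime.mpr (by norm_num)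

theorem res5 {N M : ℤ} {a r : ℤ} (ha : a % 5 = 2 ∨ a % 5 = 3) (h : N ^ 2 = a * M ^ 4 + 5 * r) :
    5 ∣ M ∧ 5 ∣ N := by
  have key : ∀ n m a' : ZMod 5, (a' = 2 ∨ a' = 3) → n ^ 2 = a' * m ^ 4 → m = 0 ∧ n = 0 := by decide
  have ha' : (a : ZMod 5) = 2 ∨ (a : ZMod 5) = 3 := by
    rcases ha with ha | ha
    · left
      exact (ZMod.intCast_eq_intCast_iff a 2 5).mpr (by unfold Int.ModEq; omega)
    · right
      exact (ZMod.intCast_eq_intCast_iff a 3 5).mpr (by unfold Int.ModEq; omega)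
  have h5 : (5 : ZMod 5) = 0 := by decide
  have := key N M a ha' (by
    have := congrArg (Int.cast : ℤ → ZMod 5) h
    push_cast at this
    rw [this, h5]; ring)
  exact ⟨(ZMod.intCast_zmod_eq_zero_iff_dvd M 5).mp this.1,
    (ZMod.intCast_zmod_eq_zero_iff_dvd N 5).mp this.2⟩

theorem res3 {N M : ℤ} {a r : ℤ} (ha : a % 3 = 2) (h : N ^ 2 = a * M ^ 4 + 3 * r) :
    3 ∣ M ∧ 3 ∣ N := by
  have key : ∀ n m : ZMod 3, n ^ 2 = 2 * m ^ 4 → m = 0 ∧ n = 0 := by decide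
  have ha' : (a : ZMod 3) = 2 :=
    (ZMod.intCast_eq_intCast_iff a 2 3).mpr (by unfold Int.ModEq; omega)
  have h5 : (3 : ZMod 3) = 0 := by decide
  have := key N M (by
    have := congrArg (Int.cast : ℤ → ZMod 3) h
    push_cast at this
    rw [this, h5, ha']; ring)
  exact ⟨(ZMod.intCast_zmod_eq_zero_iff_dvd M 3).mp this.1,
    (ZMod.intCast_zmod_eq_zero_iff_dvd N 3).mp this.2⟩

theorem l5a {N M e : ℤ} (a b : ℤ) (hc : IsCoprime M e) (ha : a % 5 = 2 ∨ a % 5 = 3)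
    (hb : b % 5 ≠ 0) (h : N ^ 2 = a * M ^ 4 + 125 * b * e ^ 4) : False := by
  have ⟨hM, hN⟩ := res5 (N := N) (M := M) (r := 25 * b * e ^ 4) ha (by rw [h]; ring)
  refine not_both prime5 hc hM ?_
  obtain ⟨m, rfl⟩ := hM
  obtain ⟨n, rfl⟩ := hN
  have h1 : n ^ 2 = 5 * (5 * a * m ^ 4 + b * e ^ 4) := by linarith
  obtain ⟨n', rfl⟩ : 5 ∣ n := prime5.dvd_of_dvd_pow ⟨_, h1⟩
  have h2 : b * e ^ 4 = 5 * (n' ^ 2 - a * m ^ 4) := by linarith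
  rcases prime5.dvd_or_dvd ⟨_, h2⟩ with h3 | h3
  · omega
  · exact prime5.dvd_of_dvd_pow h3

theorem l5b {N M e : ℤ} (a b : ℤ) (hc : IsCoprime M e) (hb : b % 5 = 2 ∨ b % 5 = 3)
    (ha : a % 5 ≠ 0) (h : N ^ 2 = 5 * a * M ^ 4 + 25 * b * e ^ 4) : False := by
  obtain ⟨n, rfl⟩ : 5 ∣ N :=
    prime5.dvd_of_dvd_pow (n := 2) ⟨a * M ^ 4 + 5 * b * e ^ 4, by rw [h]; ring⟩
  have h1 : a * M ^ 4 = 5 * (n ^ 2 - b * e ^ 4) := by linarith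
  have hM : 5 ∣ M := by
    rcases prime5.dvd_or_dvd ⟨_, h1⟩ with h3 | h3
    · omega
    · exact prime5.dvd_of_dvd_pow h3
  refine not_both prime5 hc hM ?_
  obtain ⟨m, rfl⟩ := hM
  exact (res5 (N := n) (r := 25 * a * m ^ 4) hb (by linarith)).1

theorem l3a {N M e : ℤ} (a b : ℤ) (hc : IsCoprime M e) (ha : a % 3 = 2)
    (hb : b % 3 = 2) (h : N ^ 2 = a * M ^ 4 + 9 * b * e ^ 4) : False := by
  have ⟨hM, hN⟩ := res3 (N := N) (M := M) (r := 3 * b * e ^ 4) ha (by rw [h]; ring)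
  refine not_both prime3 hc hM ?_
  obtain ⟨m, rfl⟩ := hM
  obtain ⟨n, rfl⟩ := hN
  exact (res3 (N := n) (r := 3 * a * m ^ 4) hb (by linarith)).1

theorem l3b {N M e : ℤ} (a b : ℤ) (hc : IsCoprime M e) (ha : a % 3 ≠ 0)
    (hb : b % 3 = a % 3) (h : N ^ 2 = 3 * a * M ^ 4 + 3 * b * e ^ 4) : False := by
  obtain ⟨n, rfl⟩ : 3 ∣ N :=
    prime3.dvd_of_dvd_pow (n := 2) ⟨a * M ^ 4 + b * e ^ 4, by rw [h]; ring⟩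
  obtain ⟨t, ht⟩ : ∃ t, b = a + 3 * t := ⟨(b - a) / 3, by omega⟩
  have h1 : a * (M ^ 4 + e ^ 4) = 3 * (n ^ 2 - t * e ^ 4) := by subst ht; linarith
  have h2 : 3 ∣ M ^ 4 + e ^ 4 := by
    rcases prime3.dvd_or_dvd ⟨_, h1⟩ with h3 | h3
    · omega
    · exact h3
  have key : ∀ m n : ZMod 3, m ^ 4 + n ^ 4 = 0 → m = 0 ∧ n = 0 := by decide
  have h4 := key M e (by
    have := (ZMod.intCast_zmod_eq_zero_iff_dvd _ 3).mpr h2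
    push_cast at this
    exact this)
  exact not_both prime3 hc ((ZMod.intCast_zmod_eq_zero_iff_dvd M 3).mp h4.1)
    ((ZMod.intCast_zmod_eq_zero_iff_dvd e 3).mp h4.2)

theorem l2 {N M e : ℤ} (a b : ℤ) (hc : IsCoprime M e) (ha : a % 2 = 0) (hb : b % 4 = 2)
    (ha4 : a % 4 = 2)
    (hab : (a + b) % 32 = 20) (h : N ^ 2 = a * M ^ 4 + b * e ^ 4) : False := by
  have hodd : ∀ z : ℤ, z % 2 = 1 → ∃ q, z ^ 4 = 16 * q + 1 := by
    intro z hz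
    have h8 : z ^ 2 % 8 = 1 := by
      have : z % 8 = 1 ∨ z % 8 = 3 ∨ z % 8 = 5 ∨ z % 8 = 7 := by omega
      rcases this with h | h | h | h <;> simp [pow_two, Int.mul_emod, h]
    obtain ⟨q, hq⟩ : ∃ q, z ^ 2 = 8 * q + 1 := ⟨z ^ 2 / 8, by omega⟩
    exact ⟨4 * q ^ 2 + q, by rw [show z ^ 4 = (z ^ 2) ^ 2 by ring, hq]; ring⟩
  have hev : ∀ z : ℤ, z % 2 = 0 → ∃ q, z ^ 4 = 16 * q := by
    intro z hz
    obtain ⟨q, rfl⟩ : ∃ q, z = 2 * q := ⟨z / 2, by omega⟩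
    exact ⟨q ^ 4, by ring⟩
  obtain ⟨a', rfl⟩ : ∃ q, a = 2 * q := ⟨a / 2, by omega⟩
  obtain ⟨b', rfl⟩ : ∃ q, b = 2 * q := ⟨b / 2, by omega⟩
  obtain ⟨n, rfl⟩ : 2 ∣ N :=
    Int.prime_two.dvd_of_dvd_pow (n := 2) ⟨a' * M ^ 4 + b' * e ^ 4, by rw [h]; ring⟩
  have h1 : 2 * n ^ 2 = a' * M ^ 4 + b' * e ^ 4 := by linarith
  rcases Int.emod_two_eq_zero_or_one M with hM | hM <;>
  rcases Int.emod_two_eq_zero_or_one e with he | he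
  · exact not_both Int.prime_two hc (by omega) (by omega)
  · obtain ⟨q, hq⟩ := hev M hM
    obtain ⟨r, hr⟩ := hodd e he
    have : b' = 2 * (n ^ 2 - 8 * a' * q - 8 * b' * r) := by rw [hq, hr] at h1; linarith
    omega
  · obtain ⟨q, hq⟩ := hodd M hM
    obtain ⟨r, hr⟩ := hev e he
    have : a' = 2 * (n ^ 2 - 8 * a' * q - 8 * b' * r) := by rw [hq, hr] at h1; linarith
    omega
  · obtain ⟨q, hq⟩ := hodd M hM
    obtain ⟨r, hr⟩ := hodd e he
    have h2 : n ^ 2 = 8 * (a' * q + b' * r) + (a' + b') / 2 := by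
      have h3 : 2 * ((a' + b') / 2) = a' + b' := by omega
      rw [hq, hr] at h1; linarith
    have h3 : n ^ 2 % 8 = 5 := by omega
    have hn : n ^ 2 % 8 = 0 ∨ n ^ 2 % 8 = 1 ∨ n ^ 2 % 8 = 4 := by
      have : n % 8 = 0 ∨ n % 8 = 1 ∨ n % 8 = 2 ∨ n % 8 = 3 ∨ n % 8 = 4 ∨ n % 8 = 5 ∨ n % 8 = 6 ∨
        n % 8 = 7 := by omega
      rcases this with h | h | h | h | h | h | h | h <;> simp [pow_two, Int.mul_emod, h]
    omega

theorem sqfree_cases {c k : ℤ} (hc : Squarefree c) (hk : c ∣ k) (h30 : k ∣ 30 ^ 4) :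
    c ∣ 30 := (hc.dvd_pow_iff_dvd (n := 4) (by norm_num)).mp (hk.trans h30)

theorem cases30 {c : ℤ} (h : c ∣ 30) : c = 1 ∨ c = 2 ∨ c = 3 ∨ c = 5 ∨ c = 6 ∨ c = 10 ∨ c = 15 ∨
    c = 30 ∨ c = -1 ∨ c = -2 ∨ c = -3 ∨ c = -5 ∨ c = -6 ∨ c = -10 ∨ c = -15 ∨ c = -30 := by
  have h1 : c ≤ 30 := Int.le_of_dvd (by norm_num) h
  have h2 : -c ≤ 30 := Int.le_of_dvd (by norm_num) ((neg_dvd).mpr h)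
  have h3 : -30 ≤ c := by omega
  interval_cases c <;> first | omega | (exfalso; revert h; decide)

theorem alpha (x y : ℚ) (h : y ^ 2 = x ^ 3 + 4500 * x) (hx : x ≠ 0) :
    ∃ r : ℚ, x = r ^ 2 ∨ x = 5 * r ^ 2 := by
  obtain ⟨c, c', M, e, N, hsq, hcc, hco, he, hxe, hN⟩ := core 4500 x y (by exact_mod_cast h) hx
  have hpos : 0 < x := by
    by_contra h0
    have : x < 0 := lt_of_le_of_ne (not_lt.mp h0) hx
    nlinarith [sq_nonneg y, sq_nonneg x, mul_pos_of_neg_of_neg this this]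
  have hcpos : 0 < c := by
    by_contra h0
    have : (c : ℚ) ≤ 0 := by exact_mod_cast not_lt.mp h0
    nlinarith [sq_nonneg ((M : ℚ) / e)]
  refine ⟨M / e, ?_⟩
  rcases cases30 (sqfree_cases hsq ⟨c', hcc.symm⟩ (by norm_num)) with
    rfl | rfl | rfl | rfl | rfl | rfl | rfl | rfl | rfl | rfl | rfl | rfl | rfl | rfl | rfl | rfl
  · left; simpa using hxe
  · exact (l5a 2 18 hco (by norm_num) (by norm_num) (by rw [hN]; congr 2; omega)).elim
  · exact (l5a 3 12 hco (by norm_num) (by norm_num) (by rw [hN]; congr 2; omega)).elim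
  · right; simpa using hxe
  · exact (l2 6 750 hco (by norm_num) (by norm_num) (by norm_num) (by norm_num)
      (by rw [hN]; congr 2; omega)).elim
  · exact (l5b 2 18 hco (by norm_num) (by norm_num) (by rw [hN]; congr 2; omega)).elim
  · exact (l5b 3 12 hco (by norm_num) (by norm_num) (by rw [hN]; congr 2; omega)).elim
  · exact (l2 30 150 hco (by norm_num) (by norm_num) (by norm_num) (by norm_num)
      (by rw [hN]; congr 2; omega)).elim
  all_goals omega

theorem alpha' (x y : ℚ) (h : y ^ 2 = x ^ 3 - 18000 * x) (hx : x ≠ 0) :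
    ∃ r : ℚ, x = r ^ 2 ∨ x = -5 * r ^ 2 := by
  obtain ⟨c, c', M, e, N, hsq, hcc, hco, he, hxe, hN⟩ :=
    core (-18000) x y (by push_cast; linarith) hx
  refine ⟨M / e, ?_⟩
  rcases cases30 (sqfree_cases hsq ⟨c', hcc.symm⟩ (by norm_num)) with
    rfl | rfl | rfl | rfl | rfl | rfl | rfl | rfl | rfl | rfl | rfl | rfl | rfl | rfl | rfl | rfl
  · left; simpa using hxe
  · exact (l5a 2 (-72) hco (by norm_num) (by norm_num) (by rw [hN]; congr 2; omega)).elim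
  · exact (l5a 3 (-48) hco (by norm_num) (by norm_num) (by rw [hN]; congr 2; omega)).elim
  · exact (l3a 5 (-400) hco (by norm_num) (by norm_num) (by rw [hN]; congr 2; omega)).elim
  · exact (l3b 2 (-1000) hco (by norm_num) (by norm_num) (by rw [hN]; congr 2; omega)).elim
  · exact (l5b 2 (-72) hco (by norm_num) (by norm_num) (by rw [hN]; congr 2; omega)).elim
  · exact (l5b 3 (-48) hco (by norm_num) (by norm_num) (by rw [hN]; congr 2; omega)).elim
  · exact (l3b 10 (-200) hco (by norm_num) (by norm_num) (by rw [hN]; congr 2; omega)).elim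
  · exact (l3a (-1) 2000 hco (by norm_num) (by norm_num) (by rw [hN]; congr 2; omega)).elim
  · exact (l5a (-2) 72 hco (by norm_num) (by norm_num) (by rw [hN]; congr 2; omega)).elim
  · exact (l5a (-3) 48 hco (by norm_num) (by norm_num) (by rw [hN]; congr 2; omega)).elim
  · right; simpa using hxe
  · exact (l3b (-2) 1000 hco (by norm_num) (by norm_num) (by rw [hN]; congr 2; omega)).elim
  · exact (l5b (-2) 72 hco (by norm_num) (by norm_num) (by rw [hN]; congr 2; omega)).elim
  · exact (l5b (-3) 48 hco (by norm_num) (by norm_num) (by rw [hN]; congr 2; omega)).elim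
  · exact (l3b (-10) 200 hco (by norm_num) (by norm_num) (by rw [hN]; congr 2; omega)).elim

/-- The halving step. -/
theorem halve (r s : ℚ) (h : s ^ 2 = r ^ 4 + 4500) :
    ∃ v w : ℚ, v ≠ 0 ∧ w ^ 2 = v ^ 4 + 4500 ∧ r * (2 * v * w) = v ^ 4 - 4500 := by
  -- step 1
  obtain ⟨s, p, h, hp⟩ : ∃ s p : ℚ, s ^ 2 = r ^ 4 + 4500 ∧ 2 * (s + r ^ 2) = p ^ 2 := by
    have hX : 2 * (s + r ^ 2) ≠ 0 := by
      intro h0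
      have : s = - r ^ 2 := by linarith
      rw [this] at h
      nlinarith
    obtain ⟨p, hp | hp⟩ := alpha' (2 * (s + r ^ 2)) (4 * r * (s + r ^ 2))
      (by linear_combination (-8 * (s + r ^ 2)) * h) hX
    · exact ⟨s, p, h, hp⟩
    · have hp0 : p ≠ 0 := by rintro rfl; simp at hp; apply hX; linarith
      refine ⟨-s, 60 / p, by linarith, ?_⟩
      field_simp
      linear_combination (2 / 5 * (r ^ 2 - s)) * hp + 4 / 5 * h
  have hp0 : p ≠ 0 := by
    rintro rfl
    have : s = - r ^ 2 := by linarith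
    rw [this] at h
    nlinarith
  have hq : (2 * r * p) ^ 2 = p ^ 4 - 18000 := by
    have : s = p ^ 2 / 2 - r ^ 2 := by linarith
    rw [this] at h
    linear_combination -4 * h
  obtain ⟨p, v, hp0, hq, hv⟩ : ∃ p v : ℚ, p ≠ 0 ∧ (2 * r * p) ^ 2 = p ^ 4 - 18000 ∧
      (p ^ 2 + 2 * r * p) / 2 = v ^ 2 := by
    have hX : (p ^ 2 + 2 * r * p) / 2 ≠ 0 := by
      intro h0
      have : 2 * r * p = - p ^ 2 := by linarith
      rw [this] at hq
      nlinarith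
    obtain ⟨v, hv | hv⟩ := alpha ((p ^ 2 + 2 * r * p) / 2) ((p ^ 2 + 2 * r * p) * p / 2)
      (by linear_combination (-(p ^ 2 + 2 * r * p) / 8) * hq) hX
    · exact ⟨p, v, hp0, hq, hv⟩
    · have hv0 : v ≠ 0 := by rintro rfl; simp at hv; apply hX; linarith
      refine ⟨-p, 30 / v, by simpa using hp0, by linarith, ?_⟩
      field_simp
      linear_combination (-1 / 5 * (p ^ 2 - 2 * r * p)) * hv - 1 / 10 * hq
  have hv0 : v ≠ 0 := by
    rintro rfl
    have : 2 * r * p = - p ^ 2 := by linarith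
    rw [this] at hq
    nlinarith
  have hw : (v * p) ^ 2 = v ^ 4 + 4500 := by
    rw [show v ^ 4 = (v ^ 2) ^ 2 by ring, mul_pow, ← hv]
    linear_combination (-1 / 4) * hq
  refine ⟨v, v * p, hv0, hw, ?_⟩
  linear_combination 2 * v ^ 2 * hv - hw

theorem descent (r s : ℚ) (h : s ^ 2 = r ^ 4 + 4500) :
    ∃ v w : ℚ, w ^ 2 = v ^ 4 + 4500 ∧ v.den < r.den := by
  obtain ⟨v, w, hv0, hw, hr⟩ := halve r s h
  refine ⟨v, w, hw, ?_⟩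
  obtain ⟨a, ha⟩ : ∃ a : ℤ, a = v.num := ⟨_, rfl⟩
  obtain ⟨b, hb⟩ : ∃ b : ℤ, b = v.den := ⟨_, rfl⟩
  obtain ⟨M, hM⟩ : ∃ a : ℤ, a = r.num := ⟨_, rfl⟩
  obtain ⟨e, he⟩ : ∃ b : ℤ, b = r.den := ⟨_, rfl⟩
  have hbpos : 0 < b := by rw [hb]; exact_mod_cast v.den_pos
  have hepos : 0 < e := by rw [he]; exact_mod_cast r.den_pos
  have hb0 : (b : ℚ) ≠ 0 := by exact_mod_cast hbpos.ne'
  have he0 : (e : ℚ) ≠ 0 := by exact_mod_cast hepos.ne'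
  have hvab : v = a / b := by
    rw [ha, hb]; push_cast; exact (Rat.num_div_den v).symm
  have hrMe : r = M / e := by
    rw [hM, he]; push_cast; exact (Rat.num_div_den r).symm
  have hcop : IsCoprime a b := by
    rw [ha, hb, Int.isCoprime_iff_gcd_eq_one]
    exact v.reduced
  suffices b < e by rw [hb, he] at this; exact_mod_cast this
  have hn : (w * b ^ 2) ^ 2 = ((a ^ 4 + 4500 * b ^ 4 : ℤ) : ℚ) := by
    push_cast
    rw [mul_pow, hw, hvab]
    field_simp
  obtain ⟨n, hn'⟩ := sq_int_of_rat _ _ hn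
  rw [hn'] at hn
  have hn2 : n ^ 2 = a ^ 4 + 4500 * b ^ 4 := by exact_mod_cast hn
  have hwn : w = n / b ^ 2 := by rw [← hn']; field_simp
  have key : M * (2 * a * b * n) = e * (a ^ 4 - 4500 * b ^ 4) := by
    rw [hrMe, hvab, hwn] at hr
    field_simp at hr
    have : (M : ℚ) * (2 * a * b * n) = e * (a ^ 4 - 4500 * b ^ 4) := by
      linear_combination hr
    exact_mod_cast this
  have hcop2 : IsCoprime b (a ^ 4 - 4500 * b ^ 4) := by
    have h3 := (hcop.symm.pow_right (n := 4)).add_mul_left_right (-4500 * b ^ 3)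
    rwa [show a ^ 4 + b * (-4500 * b ^ 3) = a ^ 4 - 4500 * b ^ 4 by ring] at h3
  obtain ⟨k, hk⟩ : b ∣ e :=
    hcop2.dvd_of_dvd_mul_right ⟨M * (2 * a * n), by rw [← key]; ring⟩
  have key2 : 2 * (M * a * n) = k * (a ^ 4 - 4500 * b ^ 4) := by
    apply mul_left_cancel₀ hbpos.ne'
    rw [hk] at key
    linear_combination key
  have hkpos : 0 < k := by
    by_contra h0
    nlinarith
  have hk1 : k ≠ 1 := by
    rintro rfl
    have ha2 : 2 ∣ a :=
      Int.prime_two.dvd_of_dvd_pow (n := 4) ⟨M * a * n + 2250 * b ^ 4, by linarith⟩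
    have hb2 : ¬ 2 ∣ b := fun h2 => not_both Int.prime_two hcop ha2 h2
    obtain ⟨a', rfl⟩ := ha2
    obtain ⟨n', rfl⟩ : 2 ∣ n :=
      Int.prime_two.dvd_of_dvd_pow (n := 2) ⟨8 * a' ^ 4 + 2250 * b ^ 4, by rw [hn2]; ring⟩
    apply hb2
    exact Int.prime_two.dvd_of_dvd_pow (n := 4)
      ⟨2 * a' ^ 4 - M * a' * n' - 562 * b ^ 4, by linarith⟩
  rw [hk]
  have : 2 ≤ k := by omega
  nlinarith

theorem no_quartic : ∀ (d : ℕ) (r s : ℚ), r.den = d → s ^ 2 ≠ r ^ 4 + 4500 := by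
  intro d
  induction d using Nat.strong_induction_on with
  | _ d ih =>
    intro r s hd h
    obtain ⟨v, w, hw, hlt⟩ := descent r s h
    exact ih v.den (hd ▸ hlt) v w rfl hw

/-- The only affine rational point on the elliptic curve `y^2 = x^3 + 4500x`
is `(0, 0)`. -/
theorem rational_points_y2_eq_x3_add_4500x (x y : ℚ)
    (h : y ^ 2 = x ^ 3 + 4500 * x) :
    x = 0 ∧ y = 0 := by
  by_cases hx : x = 0
  · subst hx
    exact ⟨rfl, by simpa using h⟩
  · exfalso
    obtain ⟨r, hr | hr⟩ := alpha x y h hx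
    · have hr0 : r ≠ 0 := by rintro rfl; simp at hr; exact hx hr
      apply no_quartic _ r (y / r) rfl
      rw [div_pow, h, hr]
      field_simp
    · have hr0 : r ≠ 0 := by rintro rfl; simp at hr; exact hx hr
      -- the translate by (0, 0)
      apply no_quartic _ (30 / r) (6 * y / r ^ 3) rfl
      rw [div_pow, mul_pow, h, hr]
      field_simp
      ring
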